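/- For the 3-uple Veronese embedding of ℙ² (d = 3, b = 0): dim K_{0,0}(ℙ²,0;3) = 1; dim K_{p,1}(ℙ²,0;3) for p = 1,…,6 equals 27, 105, 189, 189, 105, 27 respectively; dim K_{7,2}(ℙ²,0;3) = 1; and K_{p,q}(ℙ²,0;3) = 0 for all other pairs (p,q) with p ≥ 0 and q ∈ ℤ. -/

import Mathlib

open scoped TensorProduct

set_option maxHeartbeats 2000000
set_option synthInstance.maxHeartbeats 1000000

noncomputable section

/-- The dimension (over `ℂ`) of a complex vector space, as a natural number. -/
def cdim (M : Type*) [AddCommMonoid M] [Module ℂ M] : ℕ := (Module.rank ℂ M).toNat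

/-- The polynomial ring `S = ℂ[x₀,…,x_{N-1}]`. -/
abbrev PolyC (N : ℕ) : Type := MvPolynomial (Fin N) ℂ

/-- The space `S_e` of homogeneous polynomials of degree `e` (zero for `e < 0`). -/
def Sdeg (N : ℕ) (e : ℤ) : Submodule ℂ (PolyC N) :=
  if 0 ≤ e then MvPolynomial.homogeneousSubmodule (Fin N) ℂ e.toNat else ⊥

/-- The monomial `x^σ`. -/
def monoC (N : ℕ) (σ : Fin N →₀ ℕ) : PolyC N := MvPolynomial.monomial σ (1 : ℂ)

/-- The wedge product `m₁ ∧ ⋯ ∧ mₙ` as an element of the `n`-th exterior power. -/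
def wedgeE (R : Type*) [CommRing R] (M : Type*) [AddCommGroup M] [Module R M]
    (n : ℕ) (m : Fin n → M) : ↥(⋀[R]^n M) :=
  ⟨ExteriorAlgebra.ιMulti R n m, ExteriorAlgebra.ιMulti_range R n ⟨m, rfl⟩⟩

/-- The module `⋀^p S_d ⊗ S_e`. -/
abbrev KosModule (N : ℕ) (d : ℤ) (p : ℕ) (e : ℤ) : Type :=
  (↥(⋀[ℂ]^p ↥(Sdeg N d))) ⊗[ℂ] ↥(Sdeg N e)

/-- `D` satisfies the defining formula of the Koszul differential
`∂_{p+1} : ⋀^{p+1} S_d ⊗ S_e → ⋀^p S_d ⊗ S_{e'}` (for `e' = e + d`), namely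
`∂(m₁∧⋯∧m_{p+1} ⊗ f) = ∑ₖ (−1)ᵏ m₁∧⋯∧m̂ₖ∧⋯∧m_{p+1} ⊗ (mₖ·f)`; the equality is
stated after applying the (injective) inclusion `⋀^p S_d ⊗ S_{e'} → ⋀^p S_d ⊗ S`. -/
def IsKoszulDiff (N : ℕ) (d e e' : ℤ) (p : ℕ)
    (D : KosModule N d (p + 1) e →ₗ[ℂ] KosModule N d p e') : Prop :=
  ∀ (m : Fin (p + 1) → ↥(Sdeg N d)) (f : ↥(Sdeg N e)),
    TensorProduct.map (LinearMap.id (R := ℂ) (M := ↥(⋀[ℂ]^p ↥(Sdeg N d)))) (Sdeg N e').subtype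
        (D (wedgeE ℂ ↥(Sdeg N d) (p + 1) m ⊗ₜ[ℂ] f)) =
      ∑ k : Fin (p + 1), ((-1 : ℂ) ^ ((k : ℕ) + 1)) •
        (wedgeE ℂ ↥(Sdeg N d) p (fun i => m (Fin.succAbove k i)) ⊗ₜ[ℂ]
          ((m k : PolyC N) * (f : PolyC N)))

/-- A family of maps of the shape of the Koszul differentials. -/
def KFam (N : ℕ) (d : ℤ) : Type :=
  ∀ (p : ℕ) (e e' : ℤ), KosModule N d (p + 1) e →ₗ[ℂ] KosModule N d p e'

/-- The family `D` consists of the Koszul differentials (at all meaningful degrees). -/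
def IsKoszulFam (N : ℕ) (d : ℤ) (D : KFam N d) : Prop :=
  ∀ (p : ℕ) (e e' : ℤ), e' = e + d → IsKoszulDiff N d e e' p (D p e e')

/-- `dim K_{p,q}(ℙ^{N-1}, b; d)`: the dimension of the homology `ker ∂_p / im ∂_{p+1}` at the
middle term of `⋀^{p+1} S_d ⊗ S_{b+(q-1)d} → ⋀^p S_d ⊗ S_{b+qd} → ⋀^{p-1} S_d ⊗ S_{b+(q+1)d}`,
where for `p = 0` the right-hand map is the zero map (the dimension of the quotient is expressed
as `dim ker − dim (im ⊓ ker)`, which agrees with it since all spaces here are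
finite-dimensional). -/
def Kdim (N : ℕ) (d : ℤ) (D : KFam N d) (b : ℤ) : ℕ → ℤ → ℕ
  | 0, q =>
      cdim (KosModule N d 0 (b + q * d)) -
        cdim ↥(LinearMap.range (D 0 (b + (q - 1) * d) (b + q * d)))
  | p + 1, q =>
      cdim ↥(LinearMap.ker (D p (b + q * d) (b + (q + 1) * d))) -
        cdim
          ↥(LinearMap.range (D (p + 1) (b + (q - 1) * d) (b + q * d)) ⊓
            LinearMap.ker (D p (b + q * d) (b + (q + 1) * d)))

/-- The multidegree-`a` component of `⋀^p S_d ⊗ S_e`: the span of the pure tensors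
`m₁∧⋯∧m_p ⊗ f` with the `mᵢ` and `f` monomials of total multidegree `a`. -/
def KComp (N : ℕ) (d : ℤ) (p : ℕ) (e : ℤ) (a : Fin N →₀ ℕ) :
    Submodule ℂ (KosModule N d p e) :=
  Submodule.span ℂ
    { x | ∃ (σ : Fin p → (Fin N →₀ ℕ)) (τ : Fin N →₀ ℕ)
        (hσ : ∀ i, monoC N (σ i) ∈ Sdeg N d) (hτ : monoC N τ ∈ Sdeg N e),
        (∑ i, σ i) + τ = a ∧
        x = wedgeE ℂ ↥(Sdeg N d) p (fun i => (⟨monoC N (σ i), hσ i⟩ : ↥(Sdeg N d))) ⊗ₜ[ℂ]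
            (⟨monoC N τ, hτ⟩ : ↥(Sdeg N e)) }

/-- `dim K_{p,q}(ℙ^{N-1}, b; d)_a`: the dimension of the multidegree-`a` component of the
homology, i.e. of `(ker ∂_p ∩ (⋀^p S_d ⊗ S_{b+qd})_a) / (im ∂_{p+1} ∩ (⋀^p S_d ⊗ S_{b+qd})_a)`
(again expressed as a difference of dimensions). -/
def KdimA (N : ℕ) (d : ℤ) (D : KFam N d) (b : ℤ) : ℕ → ℤ → (Fin N →₀ ℕ) → ℕ
  | 0, q, a =>
      cdim ↥(KComp N d 0 (b + q * d) a) -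
        cdim
          ↥(LinearMap.range (D 0 (b + (q - 1) * d) (b + q * d)) ⊓ KComp N d 0 (b + q * d) a)
  | p + 1, q, a =>
      cdim
        ↥(LinearMap.ker (D p (b + q * d) (b + (q + 1) * d)) ⊓ KComp N d (p + 1) (b + q * d) a) -
        cdim
          ↥(LinearMap.range (D (p + 1) (b + (q - 1) * d) (b + q * d)) ⊓
            (LinearMap.ker (D p (b + q * d) (b + (q + 1) * d)) ⊓
              KComp N d (p + 1) (b + q * d) a))

/-- Build a multidegree in `Fin 3 →₀ ℕ` from three exponents. -/
def mdeg3 (i j k : ℕ) : Fin 3 →₀ ℕ := Finsupp.equivFunOnFinite.symm ![i, j, k]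

end


namespace VB
open MvPolynomial

/-- exponent table of the ten cubic monomials -/
def tbl : Fin 10 → Fin 3 → ℕ :=
  ![![3,0,0],![0,3,0],![0,0,3],![2,1,0],![2,0,1],![1,2,0],![0,2,1],![1,0,2],![0,1,2],![1,1,1]]

noncomputable def mE (i : Fin 10) : Fin 3 →₀ ℕ := Finsupp.equivFunOnFinite.symm (tbl i)

@[simp] lemma mE_apply (i : Fin 10) (j : Fin 3) : mE i j = tbl i j := rfl

noncomputable def mo (i : Fin 10) : PolyC 3 := monomial (mE i) 1

noncomputable def sg (k : Fin 10) (J : Finset (Fin 10)) : PolyC 3 :=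
  (-1) ^ (J.filter (fun j => j < k)).card

noncomputable def bd (z : Finset (Fin 10) → PolyC 3) (J : Finset (Fin 10)) : PolyC 3 :=
  ∑ k : Fin 10, if k ∈ J then 0 else sg k J * (mo k * z (insert k J))

lemma degree3 (τ : Fin 3 →₀ ℕ) : τ.degree = τ 0 + τ 1 + τ 2 := by
  rw [Finsupp.degree_eq_sum, Fin.sum_univ_three]

lemma degree_mE (i : Fin 10) : (mE i).degree = 3 := by
  rw [degree3]; simp only [mE_apply]; revert i; decide

lemma mE_inj : Function.Injective mE := by
  intro i j h
  have h' : tbl i = tbl j := by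
    ext k; exact DFunLike.congr_fun h k
  clear h
  revert i j; decide

lemma mem_Sdeg {e : ℤ} {f : PolyC 3} :
    f ∈ Sdeg 3 e ↔ ∀ τ, coeff τ f ≠ 0 → (τ.degree : ℤ) = e := by
  unfold Sdeg
  split_ifs with h
  · rw [mem_homogeneousSubmodule]
    constructor
    · intro hf τ hτ
      by_contra hne
      exact hτ (hf.coeff_eq_zero (by omega))
    · intro hf τ hτ
      have := hf τ hτ
      rw [show Finsupp.weight 1 τ = τ.degree from
        (DFunLike.congr_fun (Finsupp.degree_eq_weight_one (R := ℕ)) τ).symm]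
      omega
  · rw [Submodule.mem_bot]
    constructor
    · rintro rfl τ hτ; simp at hτ
    · intro hf; ext τ
      by_contra hne
      have := hf τ (by simpa using hne)
      omega

lemma coeff_mo (k : Fin 10) (f : PolyC 3) (τ : Fin 3 →₀ ℕ) :
    coeff τ (mo k * f) = if mE k ≤ τ then coeff (τ - mE k) f else 0 := by
  rw [mo, coeff_monomial_mul']; simp

lemma sg_cases (k J) : sg k J = 1 ∨ sg k J = -1 := neg_one_pow_eq_or _ _

lemma sg_sq (k J) : sg k J * sg k J = 1 := by
  rcases sg_cases k J with h | h <;> simp [h]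

lemma sg_mul_mem {N : Submodule ℂ (PolyC 3)} (k J) {f} (hf : f ∈ N) : sg k J * f ∈ N := by
  rcases sg_cases k J with h | h <;> simp [h, hf]

lemma mo_mul_mem_Sdeg {e : ℤ} (k) {f} (hf : f ∈ Sdeg 3 e) : mo k * f ∈ Sdeg 3 (e + 3) := by
  rw [mem_Sdeg] at *
  intro τ hτ
  rw [coeff_mo] at hτ
  split_ifs at hτ with h
  · have h1 := hf _ hτ
    have h2 : τ.degree = (τ - mE k).degree + (mE k).degree := by
      rw [← map_add, tsub_add_cancel_of_le h]
    rw [degree_mE] at h2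
    omega
  · simp at hτ

/-- polynomials all of whose monomials are divisible by one of the cubes `x_i^3`, `i < t` -/
def Nt (t : ℕ) : Submodule ℂ (PolyC 3) where
  carrier := {f | ∀ τ : Fin 3 →₀ ℕ, (∀ i : Fin 3, i.val < t → τ i < 3) → coeff τ f = 0}
  add_mem' := by
    intro f g hf hg τ hτ
    rw [coeff_add, hf τ hτ, hg τ hτ, add_zero]
  zero_mem' := by intro τ _; simp
  smul_mem' := by
    intro c f hf τ hτ
    rw [coeff_smul, hf τ hτ, smul_zero]

lemma mem_Nt {t f} : f ∈ Nt t ↔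
  ∀ τ : Fin 3 →₀ ℕ, (∀ i : Fin 3, i.val < t → τ i < 3) → coeff τ f = 0 := Iff.rfl

lemma mo_mul_mem_Nt {t} (k) {f} (hf : f ∈ Nt t) : mo k * f ∈ Nt t := by
  intro τ hτ
  rw [coeff_mo]
  split_ifs with h
  · apply hf
    intro i hi
    have := hτ i hi
    rw [Finsupp.tsub_apply]; omega
  · rfl

lemma Nt_zero {f} : f ∈ Nt 0 ↔ f = 0 := by
  rw [mem_Nt]
  constructor
  · intro h; ext τ; simpa using h τ (by simp)
  · rintro rfl; simp

lemma bd_mem_Nt {t z J} (hz : ∀ k, k ∉ J → z (insert k J) ∈ Nt t) : bd z J ∈ Nt t := by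
  refine Submodule.sum_mem _ fun k _ => ?_
  split_ifs with h
  · exact Submodule.zero_mem _
  · exact sg_mul_mem _ _ (mo_mul_mem_Nt _ (hz k h))

def Ch (t p : ℕ) (e : ℤ) (z : Finset (Fin 10) → PolyC 3) : Prop :=
  ∀ J, z J ∈ Sdeg 3 e ∧ (z J ≠ 0 → J.card = p ∧ ∀ j ∈ J, t ≤ j.val)

lemma Ch.bd {t p e z} (h : Ch t (p+1) e z) : Ch t p (e+3) (bd z) := by
  intro J
  constructor
  · refine Submodule.sum_mem _ fun k _ => ?_
    split_ifs with hk
    · exact Submodule.zero_mem _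
    · exact sg_mul_mem _ _ (mo_mul_mem_Sdeg _ (h _).1)
  · intro hJ
    obtain ⟨k, _, hk⟩ := Finset.exists_ne_zero_of_sum_ne_zero hJ
    split_ifs at hk with hkJ
    · simp at hk
    · have h2 : z (insert k J) ≠ 0 := by
        intro h0; simp [h0] at hk
      obtain ⟨h3, h4⟩ := (h _).2 h2
      rw [Finset.card_insert_of_notMem hkJ] at h3
      exact ⟨by omega, fun j hj => h4 j (Finset.mem_insert_of_mem hj)⟩

lemma sg_insert (k l J) (hl : l ∉ J) : sg k (insert l J) = if l < k then - sg k J else sg k J := by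
  unfold sg
  rw [Finset.filter_insert]
  split_ifs with h
  · rw [Finset.card_insert_of_notMem (by simp [hl]), pow_succ]; ring
  · rfl

lemma bd_bd (z J) : bd (bd z) J = 0 := by
  have h1 : bd (bd z) J = ∑ k, ∑ l, if k ∈ J ∨ l ∈ J ∨ k = l then 0 else
      sg k J * sg l (insert k J) * (mo k * mo l * z (insert l (insert k J))) := by
    conv_lhs => unfold bd
    refine Finset.sum_congr rfl fun k _ => ?_
    by_cases hk : k ∈ J
    · simp [hk]
    · simp only [hk, if_false, false_or]
      rw [Finset.mul_sum, Finset.mul_sum]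
      refine Finset.sum_congr rfl fun l _ => ?_
      by_cases hl : l ∈ J
      · simp [hl]
      · by_cases hkl : k = l
        · simp [hkl]
        · simp only [Finset.mem_insert, hl, hkl, Ne.symm hkl, or_self, if_false]; ring
  have h2 : bd (bd z) J = - bd (bd z) J := by
    conv_lhs => rw [h1, Finset.sum_comm]
    rw [h1, ← Finset.sum_neg_distrib]
    refine Finset.sum_congr rfl fun k _ => ?_
    rw [← Finset.sum_neg_distrib]
    refine Finset.sum_congr rfl fun l _ => ?_
    by_cases hk : k ∈ J
    · simp [hk]
    by_cases hl : l ∈ J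
    · simp [hl]
    by_cases hkl : k = l
    · simp [hkl]
    · simp only [hl, hk, hkl, Ne.symm hkl, or_self, if_false]
      rw [sg_insert _ _ _ hk, sg_insert _ _ _ hl, Finset.insert_comm]
      rcases lt_or_gt_of_ne hkl with h | h
      · rw [if_neg (asymm h), if_pos h]; ring
      · rw [if_pos h, if_neg (asymm h)]; ring
  have := add_eq_zero_iff_eq_neg.mpr h2
  rw [← two_mul] at this
  simpa using this

/-- relative exactness -/
def Ex (t p : ℕ) (e : ℤ) : Prop := ∀ z, Ch t p e z →
  (∀ J : Finset (Fin 10), (∀ j ∈ J, t ≤ j.val) → bd z J ∈ Nt t) →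
  ∃ c, Ch t (p+1) (e-3) c ∧ ∀ J : Finset (Fin 10), (∀ j ∈ J, t ≤ j.val) → z J - bd c J ∈ Nt t

lemma bd_peel (t : Fin 10) (z : Finset (Fin 10) → PolyC 3) (J) (hJ : ∀ j ∈ J, t < j) :
    bd z J = mo t * z (insert t J) + bd (fun J => if t ∈ J then 0 else z J) J := by
  have htJ : t ∉ J := fun h => lt_irrefl _ (hJ t h)
  rw [← sub_eq_iff_eq_add]
  unfold bd
  rw [← Finset.sum_sub_distrib, Finset.sum_eq_single t]
  · have : sg t J = 1 := by
      unfold sg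
      rw [Finset.filter_false_of_mem (fun j hj => (hJ j hj).le.not_gt)]; simp
    simp [htJ, this]
  · intro k _ hk
    by_cases hkJ : k ∈ J
    · simp [hkJ]
    · simp [hkJ, htJ, hk.symm]
  · simp

lemma bd_peel' (t : Fin 10) (z : Finset (Fin 10) → PolyC 3) (J) (hJ : ∀ j ∈ J, t < j)
    (hz : ∀ J, z J ≠ 0 → ∀ j ∈ J, t ≤ j) :
    bd z (insert t J) = - bd (fun J => if t ∈ J then 0 else z (insert t J)) J := by
  have htJ : t ∉ J := fun h => lt_irrefl _ (hJ t h)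
  unfold bd
  rw [← Finset.sum_neg_distrib]
  refine Finset.sum_congr rfl fun k _ => ?_
  by_cases hkJ : k ∈ J
  · simp [hkJ]
  by_cases hkt : k = t
  · simp [hkt]
  simp only [Finset.mem_insert, hkJ, hkt, or_self, if_false, htJ, Ne.symm hkt]
  rcases lt_or_gt_of_ne hkt with h | h
  · have : z (insert k (insert t J)) = 0 := by
      by_contra h0
      exact absurd (hz _ h0 k (Finset.mem_insert_self _ _)) (not_le.mpr h)
    rw [Finset.insert_comm t k, this]; simp
  · rw [sg_insert _ _ _ htJ, if_pos h, Finset.insert_comm]; ring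

lemma mE_single (t : Fin 3) : mE (Fin.castLE (by norm_num) t) = Finsupp.single t 3 := by
  ext i
  rw [mE_apply, Finsupp.single_apply]
  revert t i; decide

lemma step (t : Fin 3) (p : ℕ) (e : ℤ) (ih : Ex (t.val+1) p e) : Ex t.val p e := by
  intro z hz hbd
  set T : Fin 10 := Fin.castLE (by norm_num) t with hT
  have hTv : T.val = t.val := rfl
  have hmE : mE T = Finsupp.single t 3 := mE_single t
  have hzs : ∀ J, z J ≠ 0 → ∀ j ∈ J, T ≤ j := fun J h j hj => ((hz J).2 h).2 j hj
  -- `b` : the part of `z` not involving `T`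
  let b : Finset (Fin 10) → PolyC 3 := fun J => if T ∈ J then 0 else z J
  have hb : Ch (t.val+1) p e b := by
    intro J
    by_cases hTJ : T ∈ J
    · simp [b, hTJ]
    · simp only [b, hTJ, if_false]
      refine ⟨(hz J).1, fun h => ⟨((hz J).2 h).1, fun j hj => ?_⟩⟩
      have h1 := hzs J h j hj
      have h2 : T ≠ j := fun h => hTJ (h ▸ hj)
      have := lt_of_le_of_ne h1 h2
      exact this
  have hlt : ∀ J : Finset (Fin 10), (∀ j ∈ J, t.val + 1 ≤ j.val) → ∀ j ∈ J, T < j :=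
    fun J h j hj => h j hj
  have hge : ∀ J : Finset (Fin 10), (∀ j ∈ J, t.val + 1 ≤ j.val) → ∀ j ∈ J, t.val ≤ j.val :=
    fun J h j hj => by have := h j hj; omega
  have hmono : ∀ f, f ∈ Nt t.val → f ∈ Nt (t.val+1) := fun f hf τ hτ =>
    hf τ fun i hi => hτ i (by omega)
  have hmoT : ∀ f, mo T * f ∈ Nt (t.val+1) := by
    intro f τ hτ
    rw [coeff_mo, if_neg]
    intro hle
    have h1 := hle t
    have h2 := hτ t (by omega)
    rw [hmE, Finsupp.single_eq_same] at h1
    omega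
  obtain ⟨c, hc, hcb⟩ := ih b hb (by
    intro J hJ
    have h1 := hbd J (hge J hJ)
    rw [bd_peel T z J (hlt J hJ)] at h1
    have := Submodule.sub_mem _ (hmono _ h1) (hmoT (z (insert T J)))
    rwa [add_sub_cancel_left] at this)
  have hcbd := hc.bd
  rw [show e - 3 + 3 = e by ring] at hcbd
  let ee : Finset (Fin 10) → PolyC 3 := fun J => (b J - bd c J).divMonomial (mE T)
  have hee : Ch (t.val+1) p (e-3) ee := by
    intro J
    constructor
    · rw [mem_Sdeg]
      intro τ hτ
      have h1 := mem_Sdeg.mp (Submodule.sub_mem _ (hb J).1 (hcbd J).1) (mE T + τ)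
        (by simpa only [ee, coeff_divMonomial] using hτ)
      rw [map_add, degree_mE] at h1
      push_cast at h1
      omega
    · intro h
      by_cases hbJ : b J = 0
      · by_cases hcJ : bd c J = 0
        · simp [ee, hbJ, hcJ] at h
        · exact (hcbd J).2 hcJ
      · exact (hb J).2 hbJ
  have hn : ∀ J : Finset (Fin 10), (∀ j ∈ J, t.val + 1 ≤ j.val) →
      b J - bd c J - mo T * ee J ∈ Nt t.val := by
    intro J hJ τ hτ
    have h0 : b J - bd c J - mo T * ee J = (b J - bd c J).modMonomial (mE T) := by
      rw [sub_eq_iff_eq_add']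
      exact (divMonomial_add_modMonomial _ _).symm
    rw [h0]
    by_cases hle : mE T ≤ τ
    · exact coeff_modMonomial_of_le _ hle
    · rw [coeff_modMonomial_of_not_le _ hle]
      apply hcb J hJ
      intro i hi
      by_cases hit : i = t
      · subst hit
        by_contra h3
        apply hle
        rw [hmE, Finsupp.single_le_iff]
        omega
      · apply hτ
        have : i.val ≠ t.val := fun h => hit (Fin.ext h)
        omega
  -- regularity of `mo T` modulo `Nt t`
  have hreg : ∀ f, mo T * f ∈ Nt t.val → f ∈ Nt t.val := by
    intro f hf τ hτ
    have := hf (mE T + τ) (by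
      intro i hi
      rw [Finsupp.add_apply, hmE, Finsupp.single_eq_of_ne]
      · simpa using hτ i hi
      · rintro rfl; omega)
    rw [coeff_mo, if_pos (by simp)] at this
    simpa using this
  let c' : Finset (Fin 10) → PolyC 3 := fun J => if T ∈ J then ee (J.erase T) else c J
  have hcT : ∀ J, T ∈ J → c J = 0 := by
    intro J h
    by_contra h0
    have h1 := ((hc J).2 h0).2 T h
    omega
  have hc' : Ch t.val (p+1) (e-3) c' := by
    intro J
    by_cases hTJ : T ∈ J
    · simp only [c', hTJ, if_true]
      refine ⟨(hee _).1, fun h => ?_⟩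
      obtain ⟨h1, h2⟩ := (hee _).2 h
      rw [Finset.card_erase_of_mem hTJ] at h1
      have := Finset.card_pos.mpr ⟨T, hTJ⟩
      refine ⟨by omega, fun j hj => ?_⟩
      by_cases hjT : j = T
      · rw [hjT, hTv]
      · have := h2 j (Finset.mem_erase.mpr ⟨hjT, hj⟩)
        omega
    · simp only [c', hTJ, if_false]
      refine ⟨(hc _).1, fun h => ?_⟩
      obtain ⟨h1, h2⟩ := (hc _).2 h
      exact ⟨h1, hge _ h2⟩
  refine ⟨c', hc', ?_⟩
  have hres : (fun J => if T ∈ J then 0 else c' J) = c := by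
    ext1 J
    by_cases h : T ∈ J
    · simp [h, hcT J h]
    · simp [h, c']
  have heeT : ∀ J, T ∈ J → ee J = 0 := by
    intro J h
    by_contra h0
    have h1 := ((hee J).2 h0).2 T h
    omega
  have hres' : (fun J => if T ∈ J then 0 else c' (insert T J)) = ee := by
    ext1 J
    by_cases h : T ∈ J
    · simp [h, heeT J h]
    · simp [h, c']
  -- case J without T
  have key1 : ∀ J : Finset (Fin 10), (∀ j ∈ J, t.val + 1 ≤ j.val) →
      z J - bd c' J ∈ Nt t.val := by
    intro J hJ
    have hTJ : T ∉ J := fun h => lt_irrefl _ (hlt J hJ T h)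
    rw [bd_peel T c' J (hlt J hJ), hres]
    have h1 : c' (insert T J) = ee J := by simp [c', hTJ]
    rw [h1]
    have h2 := hn J hJ
    simp only [b, hTJ, if_false] at h2
    rw [sub_sub, add_comm] at h2
    exact h2
  have key2 : ∀ J : Finset (Fin 10), (∀ j ∈ J, t.val + 1 ≤ j.val) →
      z (insert T J) - bd c' (insert T J) ∈ Nt t.val := by
    intro J hJ
    have hTJ : T ∉ J := fun h => lt_irrefl _ (hlt J hJ T h)
    rw [bd_peel' T c' J (hlt J hJ) (fun J h j hj => ((hc' J).2 h).2 j hj), hres', sub_neg_eq_add]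
    apply hreg
    have h1 := hbd J (hge J hJ)
    rw [bd_peel T z J (hlt J hJ)] at h1
    change _ + bd b J ∈ _ at h1
    have h3 : bd b J = bd (fun J => b J - bd c J - mo T * ee J) J + bd (bd c) J
        + mo T * bd ee J := by
      unfold bd
      rw [Finset.mul_sum, ← Finset.sum_add_distrib, ← Finset.sum_add_distrib]
      refine Finset.sum_congr rfl fun k _ => ?_
      split_ifs
      · simp
      · ring
    have h4 : bd (fun J => b J - bd c J - mo T * ee J) J ∈ Nt t.val := by
      unfold bd
      refine Submodule.sum_mem _ fun k _ => ?_
      split_ifs with hk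
      · exact Submodule.zero_mem _
      apply sg_mul_mem
      by_cases hkT : T < k
      · refine mo_mul_mem_Nt _ (hn _ ?_)
        intro j hj
        rcases Finset.mem_insert.mp hj with rfl | hj
        · exact hkT
        · exact hJ j hj
      · have hz0 : ∀ (p' : ℕ) (e' : ℤ) (w : Finset (Fin 10) → PolyC 3), Ch (t.val+1) p' e' w →
            w (insert k J) = 0 := by
          intro p' e' w hw
          by_contra h0
          exact hkT (((hw _).2 h0).2 k (Finset.mem_insert_self _ _))
        have e1 := hz0 _ _ b hb
        have e2 := hz0 _ _ _ hcbd
        have e3 := hz0 _ _ _ hee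
        simp only [bd] at e2
        simp only [e1, e2, e3]; simp
    rw [bd_bd, add_zero] at h3
    rw [h3] at h1
    have h5 := Submodule.sub_mem _ h1 h4
    convert h5 using 1
    ring
  intro J hJ
  by_cases hTJ : T ∈ J
  · have := key2 (J.erase T) (by
      intro j hj
      obtain ⟨h1, h2⟩ := Finset.mem_erase.mp hj
      have h3 := hJ j h2
      have h4 : j.val ≠ T.val := fun h => h1 (Fin.ext h)
      omega)
    rwa [Finset.insert_erase hTJ] at this
  · apply key1 J
    intro j hj
    have h3 := hJ j hj
    have h4 : j.val ≠ T.val := fun h => hTJ (by rw [← Fin.ext h]; exact hj)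
    omega

end VB

namespace VB
open MvPolynomial

def dual : Fin 10 → Fin 10 := ![0,1,2,8,6,7,4,5,3,9]

noncomputable def ww : Fin 3 →₀ ℕ := Finsupp.equivFunOnFinite.symm (fun _ => 2)

@[simp] lemma ww_apply (i) : ww i = 2 := rfl

lemma mE_add_dual (l k : Fin 10) (hk : 3 ≤ k.val) : mE l + mE (dual k) = ww ↔ l = k := by
  have h1 : mE l + mE (dual k) = ww ↔ ∀ i, tbl l i + tbl (dual k) i = 2 := by
    constructor
    · intro h i; exact DFunLike.congr_fun h i
    · intro h; ext i; exact h i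
  rw [h1]; clear h1; revert l k; decide

lemma exists_mE (τ : Fin 3 →₀ ℕ) (h : τ.degree = 3) : ∃ l, mE l = τ := by
  rw [degree3] at h
  have h1 : ∀ a : Fin 4, ∀ b : Fin 4, ∀ c : Fin 4, a.val + b.val + c.val = 3 →
    ∃ l, tbl l 0 = a.val ∧ tbl l 1 = b.val ∧ tbl l 2 = c.val := by decide
  obtain ⟨l, h2, h3, h4⟩ := h1 ⟨τ 0, by omega⟩ ⟨τ 1, by omega⟩ ⟨τ 2, by omega⟩ h
  refine ⟨l, ?_⟩
  ext i
  fin_cases i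
  · exact h2
  · exact h3
  · exact h4

lemma tbl_lt (l : Fin 10) (h : ∀ i, tbl l i < 3) : 3 ≤ l.val := by
  revert l; decide

lemma tbl_lt' (l : Fin 10) (h : 3 ≤ l.val) : ∀ i, tbl l i < 3 := by
  revert l; decide

lemma dual_ge (l : Fin 10) (h : 3 ≤ l.val) : 3 ≤ (dual l).val := by revert l; decide

lemma dual_dual (l : Fin 10) : dual (dual l) = l := by revert l; decide

/-- the seven squarefree-type monomials -/
def F7 : Finset (Fin 10) := Finset.univ.filter fun j => 3 ≤ j.val

lemma sub_F7 {J : Finset (Fin 10)} : (∀ j ∈ J, 3 ≤ j.val) ↔ J ⊆ F7 := by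
  simp [F7, Finset.subset_iff]

lemma card_F7 : F7.card = 7 := by decide

lemma Ch_zero (t p e) : Ch t p e (fun _ => 0) := fun _ => ⟨Submodule.zero_mem _, by simp⟩

lemma bd_zero (J) : bd (fun _ => 0) J = 0 := by simp [bd]

lemma Ex_of_mem {p : ℕ} {e : ℤ} (h : ∀ z, Ch 3 p e z →
    (∀ J : Finset (Fin 10), (∀ j ∈ J, 3 ≤ j.val) → bd z J ∈ Nt 3) → ∀ J, z J ∈ Nt 3) :
    Ex 3 p e := by
  intro z hz hb
  refine ⟨fun _ => 0, Ch_zero _ _ _, fun J _ => ?_⟩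
  rw [bd_zero, sub_zero]
  exact h z hz hb J

lemma Ex_p8 (p : ℕ) (e : ℤ) (hp : 8 ≤ p) : Ex 3 p e := by
  apply Ex_of_mem
  intro z hz _ J
  by_cases h : z J = 0
  · rw [h]; exact Submodule.zero_mem _
  · obtain ⟨h1, h2⟩ := (hz J).2 h
    have := Finset.card_le_card (sub_F7.mp h2)
    rw [card_F7] at this
    omega

lemma Ex_big (p : ℕ) (e : ℤ) (he : 7 ≤ e) : Ex 3 p e := by
  apply Ex_of_mem
  intro z hz _ J τ hτ
  by_contra h
  have h1 := mem_Sdeg.mp (hz J).1 τ h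
  rw [degree3] at h1
  have := hτ 0 (by simp)
  have := hτ 1 (by simp)
  have := hτ 2 (by simp)
  push_cast at h1
  omega

lemma Ex_neg (p : ℕ) (e : ℤ) (he : e < 0) : Ex 3 p e := by
  apply Ex_of_mem
  intro z hz _ J τ hτ
  by_contra h
  have h1 := mem_Sdeg.mp (hz J).1 τ h
  omega

lemma coeff_sg_mul (k J f τ) : coeff τ (sg k J * f) = 0 ↔ coeff τ f = 0 := by
  rcases sg_cases k J with h | h <;> simp [h]

lemma coeff_sg_zero (k J) {f : PolyC 3} {τ} (h : coeff τ f = 0) : coeff τ (sg k J * f) = 0 := by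
  rwa [coeff_sg_mul]

lemma Ex_e0 (p : ℕ) (hp : 1 ≤ p) : Ex 3 p 0 := by
  apply Ex_of_mem
  intro z hz hb J
  by_cases hJ : z J = 0
  · rw [hJ]; exact Submodule.zero_mem _
  exfalso
  obtain ⟨h1, h2⟩ := (hz J).2 hJ
  obtain ⟨k, hk⟩ : J.Nonempty := by rw [← Finset.card_pos]; omega
  have h3 := hb (J.erase k) (fun j hj => h2 j (Finset.mem_of_mem_erase hj)) (mE k)
    (fun i _ => tbl_lt' k (h2 k hk) i)
  unfold bd at h3
  rw [coeff_sum, Finset.sum_eq_single k] at h3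
  · rw [if_neg (by simp), coeff_sg_mul, coeff_mo, if_pos le_rfl, Finset.insert_erase hk,
      tsub_self] at h3
    apply hJ
    ext τ
    by_contra h
    have h4 := mem_Sdeg.mp (hz J).1 τ (by simpa using h)
    have h5 : τ = 0 := by
      rw [← Finsupp.degree_eq_zero_iff]; exact_mod_cast h4
    rw [h5] at h
    exact h h3
  · intro l _ hl
    split_ifs with hlJ
    · simp
    · apply coeff_sg_zero
      rw [coeff_mo]
      split_ifs with hle
      · by_contra h
        have h4 := mem_Sdeg.mp (hz _).1 _ h
        have h5 : mE k - mE l = 0 := by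
          rw [← Finsupp.degree_eq_zero_iff]; exact_mod_cast h4
        exact hl (mE_inj (le_antisymm hle (tsub_eq_zero_iff_le.mp h5)))
      · rfl
  · simp

lemma Ex_73 : Ex 3 7 3 := by
  apply Ex_of_mem
  intro z hz hb J
  by_cases hJ : z J = 0
  · rw [hJ]; exact Submodule.zero_mem _
  obtain ⟨h1, h2⟩ := (hz J).2 hJ
  have hJF : J = F7 := Finset.eq_of_subset_of_card_le (sub_F7.mp h2) (by rw [card_F7, h1])
  intro τ hτ
  by_contra hne
  have h3 := mem_Sdeg.mp (hz J).1 τ hne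
  obtain ⟨l, rfl⟩ := exists_mE τ (by exact_mod_cast h3)
  have hl : 3 ≤ l.val := tbl_lt l (fun i => hτ i (by omega))
  set k := dual l with hk
  have hk3 : 3 ≤ k.val := dual_ge l hl
  have hkJ : k ∈ J := by rw [hJF]; simp [F7, hk3]
  have h4 := hb (J.erase k) (fun j hj => h2 j (Finset.mem_of_mem_erase hj)) ww
    (fun i _ => by simp)
  unfold bd at h4
  have hw : ww = mE k + mE l := by
    have := (mE_add_dual l l hl).mpr rfl
    rw [← this, add_comm]
  rw [coeff_sum, Finset.sum_eq_single k] at h4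
  · rw [if_neg (by simp), coeff_sg_mul, coeff_mo, if_pos (by rw [hw]; simp),
      Finset.insert_erase hkJ] at h4
    apply hne
    rw [← h4, hw]; simp
  · intro m _ hm
    split_ifs with hmJ
    · simp
    · have : z (insert m (J.erase k)) = 0 := by
        by_contra h
        obtain ⟨h5, h6⟩ := (hz _).2 h
        have h7 : insert m (J.erase k) = F7 :=
          Finset.eq_of_subset_of_card_le (sub_F7.mp h6) (by rw [card_F7, h5])
        have h8 : k ∈ insert m (J.erase k) := by rw [h7, ← hJF]; exact hkJ
        simp [hm.symm] at h8
      rw [this]; simp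
  · simp

lemma Ex_03 : Ex 3 0 3 := by
  intro z hz _
  let c : Finset (Fin 10) → PolyC 3 := fun K =>
    if K.card = 1 ∧ ∀ j ∈ K, 3 ≤ j.val then C (∑ k ∈ K, coeff (mE k) (z ∅)) else 0
  have hc : Ch 3 (0+1) (3-3) c := by
    intro K
    by_cases hK : K.card = 1 ∧ ∀ j ∈ K, 3 ≤ j.val
    · refine ⟨?_, fun _ => hK⟩
      simp only [c, hK]
      rw [mem_Sdeg]
      intro τ hτ
      rw [if_pos ⟨trivial, hK.2⟩, coeff_C] at hτ
      split_ifs at hτ with h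
      · rw [← h]; simp
      · simp at hτ
    · simp [c, hK]
  refine ⟨c, hc, fun J hJ => ?_⟩
  by_cases hJ0 : J = ∅
  · subst hJ0
    intro τ hτ
    rw [coeff_sub, sub_eq_zero]
    have hterm : ∀ k : Fin 10, coeff τ (sg k ∅ * (mo k * c (insert k ∅))) =
        if τ = mE k then coeff τ (z ∅) else 0 := by
      intro k
      have h1 : sg k ∅ = 1 := by simp [sg]
      rw [h1, one_mul]
      by_cases hk : 3 ≤ k.val
      · have h2 : c (insert k ∅) = C (coeff (mE k) (z ∅)) := by simp [c, hk]
        rw [h2, mo, mul_comm, coeff_C_mul, coeff_monomial]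
        by_cases h : τ = mE k
        · simp [h]
        · simp [h, Ne.symm h]
      · have h2 : c (insert k ∅) = 0 := by simp [c, hk]
        rw [h2, if_neg]
        · simp
        · rintro rfl
          exact hk (tbl_lt k fun i => hτ i (by omega))
    unfold bd
    rw [coeff_sum]
    simp only [Finset.notMem_empty, if_false, hterm]
    by_cases h0 : coeff τ (z ∅) = 0
    · simp [h0]
    · have h3 := mem_Sdeg.mp (hz ∅).1 τ h0
      obtain ⟨l, rfl⟩ := exists_mE τ (by exact_mod_cast h3)
      simp [mE_inj.eq_iff]
  · have h1 : z J = 0 := by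
      by_contra h
      exact hJ0 (Finset.card_eq_zero.mp ((hz J).2 h).1)
    have h2 : bd c J = 0 := by
      by_contra h
      exact hJ0 (Finset.card_eq_zero.mp ((hc.bd J).2 h).1)
    rw [h1, h2, sub_zero]
    exact Submodule.zero_mem _

lemma exists_kappa : ∃ κ : Finset (Fin 10) → Fin 10, ∀ J : Finset (Fin 10), J.card ≤ 6 →
    κ J ∉ J ∧ 3 ≤ (κ J).val := by
  have : ∀ J : Finset (Fin 10), ∃ k : Fin 10, J.card ≤ 6 → k ∉ J ∧ 3 ≤ k.val := by
    intro J
    by_cases hJ : J.card ≤ 6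
    · obtain ⟨k, hk, hkJ⟩ := Finset.exists_mem_notMem_of_card_lt_card
        (show J.card < F7.card by rw [card_F7]; omega)
      exact ⟨k, fun _ => ⟨hkJ, by simpa [F7] using hk⟩⟩
    · exact ⟨0, fun h => absurd h hJ⟩
  choose κ h using this
  exact ⟨κ, h⟩

lemma Ex_6 (p : ℕ) (hp : p ≤ 6) : Ex 3 p 6 := by
  intro z hz _
  obtain ⟨κ, hκ⟩ := exists_kappa
  let c : Finset (Fin 10) → PolyC 3 := fun K =>
    ∑ k ∈ K, if κ (K.erase k) = k then
      sg k (K.erase k) * (C (coeff ww (z (K.erase k))) * mo (dual k)) else 0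
  have hc : Ch 3 (p+1) (6-3) c := by
    intro K
    constructor
    · refine Submodule.sum_mem _ fun k _ => ?_
      split_ifs with hk
      · apply sg_mul_mem
        rw [mem_Sdeg]
        intro τ hτ
        rw [coeff_C_mul, mo, coeff_monomial] at hτ
        split_ifs at hτ with h
        · rw [← h, degree_mE]; norm_num
        · simp at hτ
      · exact Submodule.zero_mem _
    · intro h
      obtain ⟨k, hkK, hk⟩ := Finset.exists_ne_zero_of_sum_ne_zero h
      split_ifs at hk with hκk
      · have h0 : z (K.erase k) ≠ 0 := by
          intro h0; simp [h0] at hk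
        obtain ⟨h1, h2⟩ := (hz _).2 h0
        have h3 := (hκ (K.erase k) (by omega)).2
        rw [hκk] at h3
        rw [Finset.card_erase_of_mem hkK] at h1
        have := Finset.card_pos.mpr ⟨k, hkK⟩
        refine ⟨by omega, fun j hj => ?_⟩
        by_cases hjk : j = k
        · rw [hjk]; exact h3
        · exact h2 j (Finset.mem_erase.mpr ⟨hjk, hj⟩)
      · simp at hk
  refine ⟨c, hc, fun J hJ τ hτ => ?_⟩
  by_cases hJp : J.card = p
  swap
  · have h1 : z J = 0 := by
      by_contra h
      exact hJp ((hz J).2 h).1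
    have h2 : bd c J = 0 := by
      by_contra h
      exact hJp ((hc.bd J).2 h).1
    simp [h1, h2]
  have hbdc := (hc.bd J).1
  by_cases hτw : τ = ww
  swap
  · by_contra hne
    apply hτw
    have h1 := mem_Sdeg.mp (Submodule.sub_mem _ (hz J).1 hbdc) τ hne
    rw [degree3] at h1
    have := hτ 0 (by simp)
    have := hτ 1 (by simp)
    have := hτ 2 (by simp)
    push_cast at h1
    ext i
    rw [ww_apply]
    fin_cases i
    · change τ 0 = 2; omega
    · change τ 1 = 2; omega
    · change τ 2 = 2; omega
  subst hτw
  rw [coeff_sub, sub_eq_zero]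
  obtain ⟨hκ1, hκ3⟩ := hκ J (by omega)
  have hterm : ∀ l k K, 3 ≤ k.val → coeff ww (mo l * (sg k K * (C (coeff ww (z K)) * mo (dual k))))
      = if l = k then coeff ww (sg k K * z K) else 0 := by
    intro l k K hk
    have h1 : coeff ww (mo l * (C (coeff ww (z K)) * mo (dual k))) =
        if l = k then coeff ww (z K) else 0 := by
      rw [mul_left_comm, coeff_C_mul, mo, mo, monomial_mul, coeff_monomial]
      simp only [mE_add_dual l k hk]
      by_cases h : l = k <;> simp [h]
    rcases sg_cases k K with h | h
    · rw [h, one_mul, one_mul, h1]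
    · rw [h, neg_one_mul, neg_one_mul, mul_neg, coeff_neg, coeff_neg, h1]
      split_ifs <;> simp
  unfold bd
  rw [coeff_sum, Finset.sum_eq_single (κ J)]
  · rw [if_neg hκ1]
    have h1 : coeff ww (sg (κ J) J * (mo (κ J) * c (insert (κ J) J))) =
        coeff ww (sg (κ J) J * (sg (κ J) J * z J)) := by
      have h2 : coeff ww (mo (κ J) * c (insert (κ J) J)) = coeff ww (sg (κ J) J * z J) := by
        simp only [c]
        rw [Finset.mul_sum, coeff_sum, Finset.sum_eq_single (κ J)]
        · rw [Finset.erase_insert hκ1, if_pos rfl, hterm _ _ _ hκ3, if_pos rfl]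
        · intro k hk hkne
          split_ifs with h
          · have hcard : ((insert (κ J) J).erase k).card ≤ 6 := by
              rw [Finset.card_erase_of_mem hk, Finset.card_insert_of_notMem hκ1]; omega
            have h3 := (hκ _ hcard).2
            rw [h] at h3
            rw [hterm _ _ _ h3, if_neg hkne.symm]
          · simp
        · intro h; exact absurd (Finset.mem_insert_self _ _) h
      rcases sg_cases (κ J) J with h | h
      · rw [h, one_mul, one_mul, h2, h]
      · rw [h, neg_one_mul, neg_one_mul, coeff_neg, coeff_neg, h2, h]
    rw [h1, ← mul_assoc, sg_sq, one_mul]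
  · intro l _ hl
    split_ifs with hlJ
    · simp
    · apply coeff_sg_zero
      simp only [c]
      rw [Finset.mul_sum, coeff_sum]
      refine Finset.sum_eq_zero fun k hk => ?_
      split_ifs with h
      · have hcard : ((insert l J).erase k).card ≤ 6 := by
          rw [Finset.card_erase_of_mem hk, Finset.card_insert_of_notMem hlJ]; omega
        have h3 := (hκ _ hcard).2
        rw [h] at h3
        rw [hterm _ _ _ h3, if_neg]
        rintro rfl
        rw [Finset.erase_insert hlJ] at h
        exact hl h.symm
      · simp
  · simp

lemma Ex_main (p : ℕ) (q : ℤ)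
    (h : ¬((p = 0 ∧ q = 0) ∨ (1 ≤ p ∧ p ≤ 6 ∧ q = 1) ∨ (p = 7 ∧ q = 2))) : Ex 0 p (0 + q * 3) := by
  have h3 : Ex 3 p (0 + q * 3) := by
    by_cases h8 : 8 ≤ p
    · exact Ex_p8 _ _ h8
    by_cases hq : q < 0
    · exact Ex_neg _ _ (by omega)
    by_cases hq3 : 3 ≤ q
    · exact Ex_big _ _ (by omega)
    obtain rfl | rfl | rfl : q = 0 ∨ q = 1 ∨ q = 2 := by omega
    · exact Ex_e0 p (by omega)
    · obtain rfl | rfl : p = 0 ∨ p = 7 := by omega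
      · exact Ex_03
      · exact Ex_73
    · exact Ex_6 p (by omega)
  exact step 0 p _ (step 1 p _ (step 2 p _ h3))

end VB

namespace VB
open MvPolynomial Module

lemma mem_fa (τ : Fin 3 →₀ ℕ) (n : ℕ) :
    τ ∈ Finset.finsuppAntidiag (Finset.univ : Finset (Fin 3)) n ↔ τ.degree = n := by
  rw [Finset.mem_finsuppAntidiag, Finsupp.degree_eq_sum]; simp

abbrev Ix (n : ℕ) : Type :=
  {τ : Fin 3 →₀ ℕ // τ ∈ Finset.finsuppAntidiag (Finset.univ : Finset (Fin 3)) n}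

lemma monomial_mem (n : ℕ) (τ : Ix n) (c : ℂ) : monomial τ.1 c ∈ Sdeg 3 n := by
  rw [mem_Sdeg]
  intro σ hσ
  rw [coeff_monomial] at hσ
  split_ifs at hσ with h
  · rw [← h]; exact_mod_cast (mem_fa _ _).mp τ.2
  · simp at hσ

noncomputable def eqS (n : ℕ) : Sdeg 3 n ≃ₗ[ℂ] (Ix n → ℂ) where
  toFun f τ := coeff τ.1 (f : PolyC 3)
  map_add' f g := by ext τ; simp
  map_smul' c f := by ext τ; simp
  invFun g := ⟨∑ τ, monomial τ.1 (g τ), Submodule.sum_mem _ fun τ _ => monomial_mem n τ _⟩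
  left_inv f := by
    apply Subtype.ext
    ext σ
    simp only [coeff_sum, coeff_monomial]
    by_cases h : coeff σ (f : PolyC 3) = 0
    · rw [h]
      refine Finset.sum_eq_zero fun τ _ => ?_
      split_ifs with h1
      · rw [h1, h]
      · rfl
    · have h1 := mem_Sdeg.mp f.2 σ h
      have h2 : σ ∈ Finset.finsuppAntidiag (Finset.univ : Finset (Fin 3)) n := by
        rw [mem_fa]; exact_mod_cast h1
      rw [Finset.sum_eq_single ⟨σ, h2⟩]
      · simp
      · intro τ _ hτ
        rw [if_neg]
        intro h3; exact hτ (Subtype.ext h3)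
      · simp
  right_inv g := by
    ext σ
    simp only [coeff_sum, coeff_monomial]
    rw [Finset.sum_eq_single σ]
    · simp
    · intro τ _ hτ
      rw [if_neg]
      intro h3; exact hτ (Subtype.ext h3)
    · simp

noncomputable def bS (n : ℕ) : Basis (Ix n) ℂ (Sdeg 3 n) := Basis.ofEquivFun (eqS n)

lemma bS_apply (n : ℕ) (τ : Ix n) : ((bS n τ : Sdeg 3 n) : PolyC 3) = monomial τ.1 1 := by
  rw [bS, Basis.coe_ofEquivFun]
  change ∑ σ : Ix n, monomial σ.1 (Pi.single τ (1:ℂ) σ) = _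
  rw [Finset.sum_eq_single τ]
  · simp
  · intro σ _ h; simp [h]
  · simp

instance finS (e : ℤ) : Module.Finite ℂ (Sdeg 3 e) := by
  by_cases he : 0 ≤ e
  · lift e to ℕ using he
    exact Module.Finite.of_basis (bS e)
  · have : Sdeg 3 e = ⊥ := by simp [Sdeg, he]
    rw [this]; infer_instance

lemma finrank_S (n : ℕ) : finrank ℂ (Sdeg 3 n) = (n + 2).choose n := by
  rw [finrank_eq_card_basis (bS n), Fintype.card_coe, Finset.card_finsuppAntidiag_nat_eq_choose]
  congr 1
  simp; omega

lemma finrank_S_neg (e : ℤ) (he : e < 0) : finrank ℂ (Sdeg 3 e) = 0 := by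
  have : Sdeg 3 e = ⊥ := by simp [Sdeg, he]
  rw [this]; simp

noncomputable def eq10 : Ix 3 ≃ Fin 10 :=
  (Equiv.ofBijective (fun i : Fin 10 => (⟨mE i, (mem_fa _ _).mpr (degree_mE i)⟩ : Ix 3))
    ⟨fun i j h => mE_inj (congrArg Subtype.val h), fun τ => by
      obtain ⟨l, hl⟩ := exists_mE τ.1 ((mem_fa _ _).mp τ.2)
      exact ⟨l, Subtype.ext hl⟩⟩).symm

noncomputable def B3 : Basis (Fin 10) ℂ (Sdeg 3 3) := (bS 3).reindex eq10

lemma B3_apply (i : Fin 10) : ((B3 i : Sdeg 3 3) : PolyC 3) = mo i := by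
  rw [B3, Basis.reindex_apply, bS_apply]; rfl

noncomputable def cfP (p : ℕ) :
    (↥(⋀[ℂ]^p ↥(Sdeg 3 3))) ⊗[ℂ] PolyC 3 →ₗ[ℂ] (Finset (Fin 10) → PolyC 3) where
  toFun x J := if h : J.card = p then
    TensorProduct.equivFinsuppOfBasisLeft (B3.exteriorPower p) x ⟨J, h⟩ else 0
  map_add' x y := by ext1 J; by_cases h : J.card = p <;> simp [h]
  map_smul' c x := by ext1 J; by_cases h : J.card = p <;> simp [h]

lemma cfP_inj (p : ℕ) : Function.Injective (cfP p) := by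
  intro x y h
  apply (TensorProduct.equivFinsuppOfBasisLeft (B3.exteriorPower p)).injective
  ext1 ⟨J, hJ⟩
  have := congrFun h J
  have hJ' : J.card = p := hJ
  simpa only [cfP, LinearMap.coe_mk, AddHom.coe_mk, hJ', dif_pos] using this

lemma wedge_eq (p : ℕ) (g : Fin p ↪o Fin 10) :
    wedgeE ℂ (Sdeg 3 3) p (fun i => B3 (g i)) =
      B3.exteriorPower p (Set.powersetCard.ofFinEmbEquiv g) := by
  rw [exteriorPower.basis_apply, exteriorPower.ιMulti_family, Equiv.symm_apply_apply]
  rfl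

lemma cfP_basis (p : ℕ) (s : Set.powersetCard (Fin 10) p) (f : PolyC 3) (I : Finset (Fin 10)) :
    cfP p (B3.exteriorPower p s ⊗ₜ f) I = if I = s.1 then f else 0 := by
  simp only [cfP, LinearMap.coe_mk, AddHom.coe_mk,
    TensorProduct.equivFinsuppOfBasisLeft_apply_tmul_apply, Basis.repr_self]
  by_cases h : I = s.1
  · have h1 : I.card = p := by rw [h]; exact s.2
    rw [dif_pos h1, if_pos h]
    have : s = ⟨I, h1⟩ := Subtype.ext h.symm
    rw [this]; simp
  · rw [if_neg h]
    split_ifs with h1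
    · rw [Finsupp.single_eq_of_ne, zero_smul]
      intro h2; exact h (congrArg Subtype.val h2)
    · rfl

lemma cfP_wedge (p : ℕ) (g : Fin p ↪o Fin 10) (f : PolyC 3) (I : Finset (Fin 10)) :
    cfP p (wedgeE ℂ (Sdeg 3 3) p (fun i => B3 (g i)) ⊗ₜ f) I =
      if I = Finset.univ.map g.toEmbedding then f else 0 := by
  rw [wedge_eq, cfP_basis]
  rfl

noncomputable def inc (p : ℕ) (e : ℤ) :
    KosModule 3 3 p e →ₗ[ℂ] (↥(⋀[ℂ]^p ↥(Sdeg 3 3))) ⊗[ℂ] PolyC 3 :=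
  TensorProduct.map (LinearMap.id (R := ℂ) (M := ↥(⋀[ℂ]^p ↥(Sdeg 3 3)))) (Sdeg 3 e).subtype

lemma inc_inj (p e) : Function.Injective (inc p e) :=
  Module.Flat.lTensor_preserves_injective_linearMap (Sdeg 3 e).subtype
    (Submodule.subtype_injective _)

noncomputable def cf (p : ℕ) (e : ℤ) : KosModule 3 3 p e →ₗ[ℂ] (Finset (Fin 10) → PolyC 3) :=
  cfP p ∘ₗ inc p e

lemma cf_inj (p e) : Function.Injective (cf p e) := (cfP_inj p).comp (inc_inj p e)

lemma cf_basis (p : ℕ) (e : ℤ) (s : Set.powersetCard (Fin 10) p) (f : Sdeg 3 e)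
    (I : Finset (Fin 10)) :
    cf p e (B3.exteriorPower p s ⊗ₜ f) I = if I = s.1 then (f : PolyC 3) else 0 :=
  cfP_basis p s f I

lemma cf_mem (p e) (x : KosModule 3 3 p e) : Ch 0 p e (cf p e x) := by
  intro J
  constructor
  · obtain ⟨b, rfl⟩ := (TensorProduct.equivFinsuppOfBasisLeft (N := Sdeg 3 e)
      (B3.exteriorPower p)).symm.surjective x
    rw [TensorProduct.equivFinsuppOfBasisLeft_symm_apply, Finsupp.sum, map_sum, Finset.sum_apply]
    refine Submodule.sum_mem _ fun s _ => ?_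
    rw [cf_basis]
    split_ifs
    · exact (b s).2
    · exact Submodule.zero_mem _
  · intro h
    refine ⟨?_, fun j _ => Nat.zero_le _⟩
    by_contra h1
    apply h
    simp [cf, cfP, h1]

lemma cf_surj (p e) (z : Finset (Fin 10) → PolyC 3) (hz : Ch 0 p e z) : ∃ x, cf p e x = z := by
  refine ⟨∑ s : Set.powersetCard (Fin 10) p, B3.exteriorPower p s ⊗ₜ ⟨z s.1, (hz s.1).1⟩, ?_⟩
  ext1 J
  rw [map_sum, Finset.sum_apply]
  simp only [cf_basis]
  by_cases h : J.card = p
  · rw [Finset.sum_eq_single (⟨J, h⟩ : Set.powersetCard (Fin 10) p)]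
    · simp
    · intro s _ hs
      rw [if_neg]
      intro h1; exact hs (Subtype.ext h1.symm)
    · simp
  · have h0 : z J = 0 := by
      by_contra h1; exact h ((hz J).2 h1).1
    rw [h0]
    refine Finset.sum_eq_zero fun s _ => ?_
    rw [if_neg]
    intro h1; apply h; rw [h1]; exact s.2

noncomputable def bdL :
    (Finset (Fin 10) → PolyC 3) →ₗ[ℂ] (Finset (Fin 10) → PolyC 3) where
  toFun := bd
  map_add' x y := by
    ext1 J
    simp only [bd, Pi.add_apply]
    rw [← Finset.sum_add_distrib]
    refine Finset.sum_congr rfl fun k _ => ?_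
    split_ifs
    · simp
    · ring
  map_smul' c x := by
    ext1 J
    simp only [bd, Pi.smul_apply, RingHom.id_apply]
    rw [Finset.smul_sum]
    refine Finset.sum_congr rfl fun k _ => ?_
    split_ifs
    · simp
    · simp only [mul_smul_comm]

lemma comb (p : ℕ) (g : Fin (p+1) ↪o Fin 10) (k : Fin (p+1)) (I : Finset (Fin 10)) :
    (g k ∉ I ∧ insert (g k) I = Finset.univ.map g.toEmbedding) ↔
      I = Finset.univ.map ((Fin.succAboveOrderEmb k).trans g).toEmbedding := by
  have h2 : Finset.univ.map g.toEmbedding =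
      insert (g k) (Finset.univ.map ((Fin.succAboveOrderEmb k).trans g).toEmbedding) := by
    ext i
    simp only [Finset.mem_map, Finset.mem_univ, true_and, Finset.mem_insert]
    constructor
    · rintro ⟨j, rfl⟩
      by_cases hj : j = k
      · left; rw [hj]; rfl
      · obtain ⟨l, rfl⟩ := Fin.exists_succAbove_eq hj
        right; exact ⟨l, rfl⟩
    · rintro (rfl | ⟨l, rfl⟩)
      · exact ⟨k, rfl⟩
      · exact ⟨k.succAbove l, rfl⟩
  have h3 : g k ∉ Finset.univ.map ((Fin.succAboveOrderEmb k).trans g).toEmbedding := by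
    simp only [Finset.mem_map, Finset.mem_univ, true_and, not_exists]
    intro l hl
    exact Fin.succAbove_ne k l (g.injective hl)
  rw [h2]
  constructor
  · rintro ⟨h, h'⟩
    rw [← Finset.erase_insert h, h', Finset.erase_insert h3]
  · rintro rfl
    exact ⟨h3, rfl⟩

lemma sg_count (p : ℕ) (g : Fin (p+1) ↪o Fin 10) (k : Fin (p+1)) :
    sg (g k) (Finset.univ.map ((Fin.succAboveOrderEmb k).trans g).toEmbedding) =
      (-1) ^ (k : ℕ) := by
  have h0 := (comb p g k _).mpr rfl
  unfold sg
  congr 1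
  have h1 : ((Finset.univ.map ((Fin.succAboveOrderEmb k).trans g).toEmbedding).filter
      (fun j => j < g k)) = (Finset.Iio k).map g.toEmbedding := by
    have : ((Finset.univ.map ((Fin.succAboveOrderEmb k).trans g).toEmbedding).filter
      (fun j => j < g k)) = (Finset.univ.map g.toEmbedding).filter (fun j => j < g k) := by
      rw [← h0.2, Finset.filter_insert, if_neg (lt_irrefl _)]
    rw [this]
    ext i
    simp only [Finset.mem_filter, Finset.mem_map, Finset.mem_univ, true_and, Finset.mem_Iio]
    constructor
    · rintro ⟨⟨j, rfl⟩, h⟩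
      exact ⟨j, g.lt_iff_lt.mp h, rfl⟩
    · rintro ⟨j, hj, rfl⟩
      exact ⟨⟨j, rfl⟩, g.lt_iff_lt.mpr hj⟩
  rw [h1, Finset.card_map, Fin.card_Iio]

lemma cf_D (D : KFam 3 3) (hD : IsKoszulFam 3 3 D) (p : ℕ) (e e' : ℤ) (he : e' = e + 3)
    (x : KosModule 3 3 (p+1) e) : cf p e' (D p e e' x) = - bd (cf (p+1) e x) := by
  suffices h : cf p e' ∘ₗ D p e e' = - (bdL ∘ₗ cf (p+1) e) from LinearMap.congr_fun h x
  apply TensorProduct.ext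
  apply (B3.exteriorPower (p+1)).ext
  intro s
  obtain ⟨g, rfl⟩ := Set.powersetCard.ofFinEmbEquiv.surjective s
  rw [← wedge_eq]
  ext1 f
  have h1 := hD p e e' he (fun i => B3 (g i)) f
  change cf p e' (D p e e' (wedgeE ℂ (Sdeg 3 3) (p+1) (fun i => B3 (g i)) ⊗ₜ f)) =
    - bd (cf (p+1) e (wedgeE ℂ (Sdeg 3 3) (p+1) (fun i => B3 (g i)) ⊗ₜ f))
  have h2 : ∀ J, cf (p+1) e (wedgeE ℂ (Sdeg 3 3) (p+1) (fun i => B3 (g i)) ⊗ₜ f) J =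
      if J = Finset.univ.map g.toEmbedding then (f : PolyC 3) else 0 :=
    fun J => cfP_wedge (p+1) g f J
  rw [cf, LinearMap.comp_apply, inc, h1, map_sum]
  ext1 I
  rw [Finset.sum_apply, Pi.neg_apply]
  have h3 : ∀ k : Fin (p+1), cfP p (((-1 : ℂ) ^ ((k : ℕ) + 1)) •
        (wedgeE ℂ ↥(Sdeg 3 3) p (fun i => B3 (g (Fin.succAbove k i))) ⊗ₜ[ℂ]
          (((B3 (g k) : Sdeg 3 3) : PolyC 3) * (f : PolyC 3)))) I =
      if I = Finset.univ.map ((Fin.succAboveOrderEmb k).trans g).toEmbedding then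
        - ((-1) ^ (k : ℕ) * (mo (g k) * (f : PolyC 3))) else 0 := by
    intro k
    rw [map_smul, Pi.smul_apply]
    have := cfP_wedge p ((Fin.succAboveOrderEmb k).trans g)
      (((B3 (g k) : Sdeg 3 3) : PolyC 3) * (f : PolyC 3)) I
    rw [B3_apply] at this ⊢
    erw [this]
    split_ifs
    · rw [pow_succ]
      rcases neg_one_pow_eq_or ℂ (k : ℕ) with h | h
      · have h' : ((-1 : PolyC 3)) ^ (k : ℕ) = 1 := by
          have := congrArg (C (σ := Fin 3)) h; simpa using this
        rw [h, h']; simp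
      · have h' : ((-1 : PolyC 3)) ^ (k : ℕ) = -1 := by
          have := congrArg (C (σ := Fin 3)) h; simpa using this
        rw [h, h']; simp
    · simp
  refine (Finset.sum_congr rfl fun k _ => h3 k).trans ?_
  unfold bd
  simp only [h2]
  rw [← Finset.sum_neg_distrib]
  rw [← Finset.sum_subset (Finset.subset_univ (Finset.univ.map g.toEmbedding)), Finset.sum_map]
  · refine Finset.sum_congr rfl fun k _ => ?_
    change _ = - if g k ∈ I then 0 else sg (g k) I * (mo (g k) *
      if insert (g k) I = _ then (f : PolyC 3) else 0)
    by_cases h : I = Finset.univ.map ((Fin.succAboveOrderEmb k).trans g).toEmbedding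
    · obtain ⟨h4, h5⟩ := (comb p g k I).mpr h
      rw [if_pos h, if_neg h4, if_pos h5]
      rw [h, sg_count]
    · rw [if_neg h]
      by_cases h4 : g k ∈ I
      · simp [h4]
      · have h5 : insert (g k) I ≠ Finset.univ.map g.toEmbedding :=
          fun h5 => h ((comb p g k I).mp ⟨h4, h5⟩)
        rw [if_neg h4, if_neg h5]; simp
  · intro k _ hk
    have : insert k I ≠ Finset.univ.map g.toEmbedding := by
      intro h; apply hk; rw [← h]; exact Finset.mem_insert_self _ _
    simp [this]

end VB

namespace VB
open MvPolynomial Module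

lemma DD (D : KFam 3 3) (hD : IsKoszulFam 3 3 D) (p : ℕ) (e e' e'' : ℤ) (he : e' = e + 3)
    (he' : e'' = e' + 3) (x : KosModule 3 3 (p+1+1) e) :
    D p e' e'' (D (p+1) e e' x) = 0 := by
  apply cf_inj
  rw [cf_D D hD p e' e'' he', cf_D D hD (p+1) e e' he, map_zero]
  have h : bd (-bd (cf (p+1+1) e x)) = -bd (bd (cf (p+1+1) e x)) := bdL.map_neg _
  rw [h]
  ext1 J
  rw [Pi.neg_apply, Pi.neg_apply, bd_bd]; simp

lemma exact_aux (D : KFam 3 3) (hD : IsKoszulFam 3 3 D) (p : ℕ) (e e' : ℤ) (he : e = e' + 3)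
    (hEx : Ex 0 p e) (x : KosModule 3 3 p e) (hx : bd (cf p e x) = 0) :
    ∃ y, D p e' e y = x := by
  obtain ⟨c, hc, h⟩ := hEx (cf p e x) (cf_mem p e x) (by
    intro J _; rw [hx]; exact Submodule.zero_mem _)
  have hce : e - 3 = e' := by omega
  rw [hce] at hc
  obtain ⟨y, hy⟩ := cf_surj (p+1) e' c hc
  refine ⟨(-1 : ℂ) • y, cf_inj _ _ ?_⟩
  have hn : bd (-c) = -bd c := bdL.map_neg _
  have hcn : cf (p+1) e' ((-1 : ℂ) • y) = -c := by
    rw [LinearMap.map_smul, hy, neg_smul, one_smul]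
  rw [cf_D D hD p e' e he, hcn, hn, neg_neg]
  ext1 J
  have := h J (fun j _ => Nat.zero_le _)
  rw [Nt_zero, sub_eq_zero] at this
  exact this.symm

noncomputable def rr (D : KFam 3 3) (p : ℕ) (e e' : ℤ) : ℕ :=
  finrank ℂ (LinearMap.range (D p e e'))

noncomputable def kk (D : KFam 3 3) (p : ℕ) (e e' : ℤ) : ℕ :=
  finrank ℂ (LinearMap.ker (D p e e'))

lemma finrank_Kos (p : ℕ) (e : ℤ) :
    finrank ℂ (KosModule 3 3 p e) = Nat.choose 10 p * finrank ℂ (Sdeg 3 e) := by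
  rw [finrank_tensorProduct, exteriorPower.finrank_eq]
  have : finrank ℂ (Sdeg 3 3) = 10 := by
    rw [finrank_eq_card_basis B3]; simp
  rw [this]

lemma rn_abs {V W : Type*} [i1 : AddCommMonoid V] [i2 : Module ℂ V] [i3 : AddCommMonoid W]
    [i4 : Module ℂ W] [i5 : Module.Finite ℂ V] (f : V →ₗ[ℂ] W) :
    finrank ℂ (LinearMap.range f) + finrank ℂ (LinearMap.ker f) = finrank ℂ V := by
  let g1 : AddCommGroup V := Module.addCommMonoidToAddCommGroup ℂ
  let g2 : AddCommGroup W := Module.addCommMonoidToAddCommGroup ℂ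
  exact @LinearMap.finrank_range_add_finrank_ker ℂ V _ g1 i2 W g2 i4 i5 f

lemma fm_abs {V : Type*} [i1 : AddCommMonoid V] [i2 : Module ℂ V]
    [i5 : Module.Finite ℂ V] {U W : Submodule ℂ V} (h : U ≤ W) :
    finrank ℂ U ≤ finrank ℂ W := by
  let g1 : AddCommGroup V := Module.addCommMonoidToAddCommGroup ℂ
  have hf : Module.Finite ℂ W := FiniteDimensional.finiteDimensional_submodule W
  exact Submodule.finrank_mono h

lemma finite_Kos (p : ℕ) (e : ℤ) : Module.Finite ℂ (KosModule 3 3 p e) := inferInstance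

lemma rn_gen {p : ℕ} {e e' : ℤ} (f : KosModule 3 3 (p+1) e →ₗ[ℂ] KosModule 3 3 p e') :
    finrank ℂ (LinearMap.range f) + finrank ℂ (LinearMap.ker f) =
      finrank ℂ (KosModule 3 3 (p+1) e) :=
  have := finite_Kos (p+1) e
  rn_abs f

lemma fm {p : ℕ} {e : ℤ} {U W : Submodule ℂ (KosModule 3 3 p e)} (h : U ≤ W) :
    finrank ℂ U ≤ finrank ℂ W :=
  have := finite_Kos p e
  fm_abs h

lemma rn (D : KFam 3 3) (p : ℕ) (e e' : ℤ) :
    rr D p e e' + kk D p e e' = Nat.choose 10 (p+1) * finrank ℂ (Sdeg 3 e) := by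
  rw [← finrank_Kos]
  exact rn_gen (D p e e')

lemma range_le (D : KFam 3 3) (hD : IsKoszulFam 3 3 D) (p : ℕ) (e e' e'' : ℤ) (he : e' = e + 3)
    (he' : e'' = e' + 3) : LinearMap.range (D (p+1) e e') ≤ LinearMap.ker (D p e' e'') := by
  rintro _ ⟨x, rfl⟩
  exact DD D hD p e e' e'' he he' x

lemma Kdim_succ (D : KFam 3 3) (hD : IsKoszulFam 3 3 D) (p : ℕ) (q : ℤ) :
    Kdim 3 3 D 0 (p+1) q + rr D (p+1) (0 + (q-1)*3) (0 + q*3) =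
      kk D p (0 + q*3) (0 + (q+1)*3) := by
  have h := range_le D hD p (0 + (q-1)*3) (0 + q*3) (0 + (q+1)*3) (by ring) (by ring)
  have h2 := fm h
  have h3 : Kdim 3 3 D 0 (p+1) q = kk D p (0 + q*3) (0 + (q+1)*3) -
      rr D (p+1) (0 + (q-1)*3) (0 + q*3) := by
    change finrank ℂ ↥(LinearMap.ker (D p (0 + q*3) (0 + (q+1)*3))) -
      finrank ℂ ↥(LinearMap.range (D (p+1) (0 + (q-1)*3) (0 + q*3)) ⊓
        LinearMap.ker (D p (0 + q*3) (0 + (q+1)*3))) = _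
    rw [inf_eq_left.mpr h]
    rfl
  rw [h3]
  exact Nat.sub_add_cancel h2

lemma Kdim_zero (D : KFam 3 3) (q : ℤ) :
    Kdim 3 3 D 0 0 q = finrank ℂ (Sdeg 3 (0 + q*3)) - rr D 0 (0 + (q-1)*3) (0 + q*3) := by
  change finrank ℂ (KosModule 3 3 0 _) - _ = _
  rw [finrank_Kos]
  simp only [Nat.choose_zero_right, one_mul]
  rfl

lemma vanish (D : KFam 3 3) (hD : IsKoszulFam 3 3 D) (p : ℕ) (q : ℤ)
    (h : ¬((p = 0 ∧ q = 0) ∨ (1 ≤ p ∧ p ≤ 6 ∧ q = 1) ∨ (p = 7 ∧ q = 2))) :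
    Kdim 3 3 D 0 p q = 0 := by
  have hEx := Ex_main p q h
  rcases p with _ | p
  · have htop : LinearMap.range (D 0 (0 + (q-1)*3) (0 + q*3)) = ⊤ := by
      rw [eq_top_iff]
      intro x _
      refine exact_aux D hD 0 _ _ (by ring) hEx x ?_
      ext1 J
      by_contra hne
      obtain ⟨k, _, hk⟩ := Finset.exists_ne_zero_of_sum_ne_zero hne
      split_ifs at hk with hkJ
      · simp at hk
      · have h2 : cf 0 _ x (insert k J) ≠ 0 := by
          intro h0; simp [h0] at hk
        have h3 := ((cf_mem 0 _ x _).2 h2).1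
        simp at h3
    have h4 : Kdim 3 3 D 0 0 q = finrank ℂ (KosModule 3 3 0 (0 + q*3)) -
      finrank ℂ (LinearMap.range (D 0 (0 + (q-1)*3) (0 + q*3))) := rfl
    rw [h4, htop, finrank_top, Nat.sub_self]
  · have h1 := Kdim_succ D hD p q
    have h2 : kk D p (0 + q*3) (0 + (q+1)*3) ≤ rr D (p+1) (0 + (q-1)*3) (0 + q*3) := by
      apply fm
      intro x hx
      refine exact_aux D hD (p+1) _ _ (by ring) hEx x ?_
      rw [LinearMap.mem_ker] at hx
      have h3 := cf_D D hD p (0 + q*3) (0 + (q+1)*3) (by ring) x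
      rw [hx, map_zero] at h3
      exact neg_eq_zero.mp h3.symm
    omega

noncomputable def Rn (D : KFam 3 3) (p q : ℕ) : ℕ := rr D p (q * 3 : ℕ) ((q + 1) * 3 : ℕ)

lemma rr_neg (D : KFam 3 3) (p : ℕ) (e e' : ℤ) (he : e < 0) : rr D p e e' = 0 := by
  have := rn D p e e'
  rw [finrank_S_neg e he] at this
  omega

lemma euler (D : KFam 3 3) (hD : IsKoszulFam 3 3 D) (p q : ℕ) (q' : ℤ) (hq : q' = q + 1) :
    Kdim 3 3 D 0 (p+1) q' + Rn D (p+1) q + Rn D p (q+1) =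
      Nat.choose 10 (p+1) * (q * 3 + 5).choose 2 := by
  have h1 := Kdim_succ D hD p q'
  have h2 := rn D p (0 + q'*3) (0 + (q'+1)*3)
  have e1 : (0 : ℤ) + (q'-1)*3 = ((q*3 : ℕ) : ℤ) := by push_cast; rw [hq]; ring
  have e2 : (0 : ℤ) + q'*3 = (((q+1)*3 : ℕ) : ℤ) := by push_cast; rw [hq]; ring
  have e3 : (0 : ℤ) + (q'+1)*3 = (((q+1+1)*3 : ℕ) : ℤ) := by push_cast; rw [hq]; ring
  rw [e1, e2, e3] at h1
  rw [e2, e3, finrank_S] at h2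
  have e4 : ((q+1)*3+2).choose ((q+1)*3) = (q*3+5).choose 2 := by
    rw [Nat.choose_symm_add]; congr 1; ring
  rw [e4] at h2
  unfold Rn
  omega

lemma start (D : KFam 3 3) (hD : IsKoszulFam 3 3 D) (p : ℕ) :
    Rn D p 0 = Nat.choose 10 (p+1) := by
  have h0 := vanish D hD (p+1) 0 (by omega)
  have h1 := Kdim_succ D hD p 0
  have h2 := rn D p (0 + 0*3) (0 + (0+1)*3)
  rw [h0, rr_neg _ _ _ _ (by norm_num)] at h1
  have h3 := finrank_S 0
  have e2 : (0 : ℤ) + 0*3 = ((0*3 : ℕ) : ℤ) := by norm_num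
  have e3 : (0 : ℤ) + (0+1)*3 = (((0+1)*3 : ℕ) : ℤ) := by norm_num
  rw [← h1, e2, e3] at h2
  simp only [zero_mul] at h2
  rw [h3] at h2
  simpa [Rn] using h2

lemma last (D : KFam 3 3) (hD : IsKoszulFam 3 3 D) (q : ℕ) :
    Rn D 0 q = (q * 3 + 5).choose 2 := by
  have h0 := vanish D hD 0 (q+1) (by omega)
  rw [Kdim_zero] at h0
  have e1 : (0 : ℤ) + ((q+1 : ℤ)-1)*3 = ((q*3 : ℕ) : ℤ) := by push_cast; ring
  have e2 : (0 : ℤ) + (q+1 : ℤ)*3 = (((q+1)*3 : ℕ) : ℤ) := by push_cast; ring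
  rw [e1, e2, finrank_S] at h0
  have e4 : ((q+1)*3+2).choose ((q+1)*3) = (q*3+5).choose 2 := by
    rw [Nat.choose_symm_add]; congr 1; ring
  rw [e4] at h0
  have h1 : rr D 0 ((q*3 : ℕ) : ℤ) (((q+1)*3 : ℕ) : ℤ) ≤
      finrank ℂ (KosModule 3 3 0 (((q+1)*3 : ℕ) : ℤ)) := Submodule.finrank_le _
  rw [finrank_Kos, finrank_S, e4, Nat.choose_zero_right, one_mul] at h1
  unfold Rn
  omega

/-- recursion for the ranks, valid where the homology vanishes -/
lemma rec0 (D : KFam 3 3) (hD : IsKoszulFam 3 3 D) (p q : ℕ)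
    (h : ¬((1 ≤ p + 1 ∧ p + 1 ≤ 6 ∧ q = 0) ∨ (p + 1 = 7 ∧ q = 1))) :
    Rn D (p+1) q + Rn D p (q+1) = Nat.choose 10 (p+1) * (q * 3 + 5).choose 2 := by
  have h1 := euler D hD p q _ rfl
  rw [vanish D hD (p+1) _ (by omega)] at h1
  omega

end VB

/-- Betti table of the pushforward of O(b=0) under the 3-uple Veronese embedding of P^2. -/
theorem veronese_betti_P2_b0_d3 (D : KFam 3 3) (hD : IsKoszulFam 3 3 D) :
    Kdim 3 3 D 0 0 0 = 1 ∧
    Kdim 3 3 D 0 1 1 = 27 ∧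
    Kdim 3 3 D 0 2 1 = 105 ∧
    Kdim 3 3 D 0 3 1 = 189 ∧
    Kdim 3 3 D 0 4 1 = 189 ∧
    Kdim 3 3 D 0 5 1 = 105 ∧
    Kdim 3 3 D 0 6 1 = 27 ∧
    Kdim 3 3 D 0 7 2 = 1 ∧
    (∀ (p : ℕ) (q : ℤ), ¬((p = 0 ∧ q = 0) ∨ (1 ≤ p ∧ p ≤ 6 ∧ q = 1) ∨ (p = 7 ∧ q = 2)) →
      Kdim 3 3 D 0 p q = 0) := by
  have S := VB.start D hD
  have La := VB.last D hD
  have R := VB.rec0 D hD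
  refine ⟨?_, ?_, ?_, ?_, ?_, ?_, ?_, ?_, VB.vanish D hD⟩
  · rw [VB.Kdim_zero, VB.rr_neg _ _ _ _ (by norm_num)]
    have := VB.finrank_S 0
    simpa using this
  · have e := VB.euler D hD 0 0 1 (by norm_num)
    have a := S 1
    have b := La 1
    norm_num [Nat.choose] at e a b
    omega
  · have e := VB.euler D hD 1 0 1 (by norm_num)
    have a := S 2
    have r1 := R 0 1 (by omega)
    have b := La 2
    norm_num [Nat.choose] at e a b r1
    omega
  · have e := VB.euler D hD 2 0 1 (by norm_num)
    have a := S 3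
    have r1 := R 1 1 (by omega)
    have r2 := R 0 2 (by omega)
    have b := La 3
    norm_num [Nat.choose] at e a b r1 r2
    omega
  · have e := VB.euler D hD 3 0 1 (by norm_num)
    have a := S 4
    have r1 := R 2 1 (by omega)
    have r2 := R 1 2 (by omega)
    have r3 := R 0 3 (by omega)
    have b := La 4
    norm_num [Nat.choose] at e a b r1 r2 r3
    omega
  · have e := VB.euler D hD 4 0 1 (by norm_num)
    have a := S 5
    have r1 := R 3 1 (by omega)
    have r2 := R 2 2 (by omega)
    have r3 := R 1 3 (by omega)
    have r4 := R 0 4 (by omega)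
    have b := La 5
    norm_num [Nat.choose] at e a b r1 r2 r3 r4
    omega
  · have e := VB.euler D hD 5 0 1 (by norm_num)
    have a := S 6
    have r1 := R 4 1 (by omega)
    have r2 := R 3 2 (by omega)
    have r3 := R 2 3 (by omega)
    have r4 := R 1 4 (by omega)
    have r5 := R 0 5 (by omega)
    have b := La 6
    norm_num [Nat.choose] at e a b r1 r2 r3 r4 r5
    omega
  · have e := VB.euler D hD 6 1 2 (by norm_num)
    have a := S 8
    have r0 := R 7 0 (by omega)
    have r1 := R 5 2 (by omega)
    have r2 := R 4 3 (by omega)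
    have r3 := R 3 4 (by omega)
    have r4 := R 2 5 (by omega)
    have r5 := R 1 6 (by omega)
    have r6 := R 0 7 (by omega)
    have b := La 8
    norm_num [Nat.choose] at e a b r0 r1 r2 r3 r4 r5 r6
    omega
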